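/- Let F, G, F' be BIAs with input error model MI and output error model MO restricted with respect to G, such that F⊗MO is composable with G and shared(F',G) ⊆ shared(F,G). If F⊗MO is compatible with G (F⊗MO ∼ G) and F'⊗MI refines F⊗MO (F⊗MO ⪰ F'⊗MI), then F' is compatible with G (F' ∼ G). -/

import Mathlib

open scoped Classical

/-! ### Game graphs, strategies, plays, objectives -/

/-- A two-player game graph: a set of states partitioned into Player-1 states `S1`
and Player-2 states `S2`, an edge relation `E` in which every state has at least one
outgoing edge, and an initial state `init`. -/
structure GameGraph (S : Type) where
  S1 : Set S
  S2 : Set S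
  partition : ∀ s, s ∈ S1 ↔ s ∉ S2
  E : S → S → Prop
  init : S
  serial : ∀ s, ∃ t, E s t

/-- A strategy for the player owning the states in `P`: given the history `w` and the
current state `s ∈ P`, it chooses a successor along an edge. -/
structure Strat {S : Type} (H : GameGraph S) (P : Set S) where
  f : List S → S → S
  valid : ∀ w s, s ∈ P → H.E s (f w s)

/-- A strategy is memoryless (positional) if its choice does not depend on the history. -/
def Strat.Memoryless {S : Type} {H : GameGraph S} {P : Set S} (π : Strat H P) : Prop :=
  ∀ w w' s, π.f w s = π.f w' s

/-- Auxiliary: the pair (history, current state) after `n` steps when Player 1 plays `π1`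
and Player 2 plays `π2`. -/
noncomputable def GameGraph.hist {S : Type} (H : GameGraph S)
    (π1 : Strat H H.S1) (π2 : Strat H H.S2) : ℕ → List S × S
  | 0 => ([], H.init)
  | n + 1 =>
      let p := GameGraph.hist H π1 π2 n
      (p.1 ++ [p.2], if p.2 ∈ H.S1 then π1.f p.1 p.2 else π2.f p.1 p.2)

/-- The unique play `Out_H(π1, π2)` conformant to both strategies. -/
noncomputable def GameGraph.outcome {S : Type} (H : GameGraph S)
    (π1 : Strat H H.S1) (π2 : Strat H H.S2) : ℕ → S :=
  fun n => (H.hist π1 π2 n).2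

/-- A play of the game graph: an infinite sequence of states starting at the initial state
and following edges. -/
def GameGraph.IsPlay {S : Type} (H : GameGraph S) (ρ : ℕ → S) : Prop :=
  ρ 0 = H.init ∧ ∀ n, H.E (ρ n) (ρ (n + 1))

/-- A play `ρ` is conformant to a strategy `π` (of the player owning `P`) if at every
position in `P` the play follows the choice of `π`. -/
def Conformant {S : Type} {H : GameGraph S} {P : Set S} (π : Strat H P) (ρ : ℕ → S) : Prop :=
  ∀ n, ρ n ∈ P → ρ (n + 1) = π.f (List.ofFn fun i : Fin n => ρ i) (ρ n)

/-- The limit-average objective `LimAvg(ρ) = liminf (1/n)·Σ_{i<n} ω(ρ i, ρ (i+1))`. -/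
noncomputable def limAvg {S : Type} (ω : S → S → ℤ) (ρ : ℕ → S) : ℝ :=
  Filter.liminf
    (fun n : ℕ => (∑ i ∈ Finset.range n, (ω (ρ i) (ρ (i + 1)) : ℝ)) / (n : ℝ))
    Filter.atTop

/-- The discounted-sum objective `Disc_λ(ρ) = Σ_i λ^i · ω(ρ i, ρ (i+1))`. -/
noncomputable def disc {S : Type} (lam : ℝ) (ω : S → S → ℤ) (ρ : ℕ → S) : ℝ :=
  ∑' i : ℕ, lam ^ i * (ω (ρ i) (ρ (i + 1)) : ℝ)

/-- The lower value `sup_{π1} inf_{π2} f(Out(π1,π2))` of the game (in `EReal`). -/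
noncomputable def GameGraph.supInf {S : Type} (H : GameGraph S) (f : (ℕ → S) → ℝ) : EReal :=
  ⨆ π1 : Strat H H.S1, ⨅ π2 : Strat H H.S2, ((f (H.outcome π1 π2) : ℝ) : EReal)

/-- The upper value `inf_{π2} sup_{π1} f(Out(π1,π2))` of the game (in `EReal`). -/
noncomputable def GameGraph.infSup {S : Type} (H : GameGraph S) (f : (ℕ → S) → ℝ) : EReal :=
  ⨅ π2 : Strat H H.S2, ⨆ π1 : Strat H H.S1, ((f (H.outcome π1 π2) : ℝ) : EReal)

/-! ### Interface automata -/

/-- An interface automaton (transition system with input and output actions).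
Broadcast interface automata (BIAs) are those satisfying `IA.IsBIA`; systems modified
by an error model are interface automata that need not be input-deterministic. -/
structure IA (Q : Type) (Act : Type) where
  init : Q
  AI : Set Act
  AO : Set Act
  delta : Q → Act → Q → Prop

namespace IA

/-- `F` is a broadcast interface automaton: inputs and outputs are disjoint, transitions
are labeled by actions, and `F` is input-deterministic. -/
structure IsBIA {Q Act : Type} (F : IA Q Act) : Prop where
  disj : Disjoint F.AI F.AO
  dom : ∀ q a q', F.delta q a q' → a ∈ F.AI ∪ F.AO
  inputDet : ∀ q a q' q'', a ∈ F.AI → F.delta q a q' → F.delta q a q'' → q' = q''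

/-- The input actions enabled at state `q` (written `AI(q)`). -/
def enabledI {Q Act : Type} (F : IA Q Act) (q : Q) : Set Act :=
  {a | a ∈ F.AI ∧ ∃ q', F.delta q a q'}

/-- The output actions enabled at state `q` (written `AO(q)`). -/
def enabledO {Q Act : Type} (F : IA Q Act) (q : Q) : Set Act :=
  {a | a ∈ F.AO ∧ ∃ q', F.delta q a q'}

/-- `R` is an alternating simulation by `F` of `F'`. -/
def AltSim {Q Q' Act : Type} (F : IA Q Act) (F' : IA Q' Act) (R : Q → Q' → Prop) : Prop :=
  ∀ q q', R q q' →
    (∀ a ∈ F.AI, ∀ r, F.delta q a r → ∃ r', F'.delta q' a r' ∧ R r r') ∧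
    (∀ a ∈ F'.AO, ∀ r', F'.delta q' a r' → ∃ r, F.delta q a r ∧ R r r')

/-- `F'` refines `F`, written `F ⪰ F'`. -/
def Refines {Q Q' Act : Type} (F : IA Q Act) (F' : IA Q' Act) : Prop :=
  F.AI ⊆ F'.AI ∧ F'.AO ⊆ F.AO ∧ ∃ R, AltSim F F' R ∧ R F.init F'.init

end IA

/-! ### Error models and modified systems -/

/-- An error model on the action set `D` (the inputs, resp. the outputs): a partial
cost function (`none` plays the role of `⊥` = infinity) which is reflexive with cost `0`
and satisfies the triangle inequality. -/
structure ErrorModel (Act : Type) (D : Set Act) where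
  M : Act → Act → Option ℕ
  dom : ∀ a b, M a b ≠ none → a ∈ D ∧ b ∈ D
  refl : ∀ a ∈ D, M a a = some 0
  triangle : ∀ a b c x y, M a b = some x → M b c = some y → ∃ z, z ≤ x + y ∧ M a c = some z

namespace IA

/-- The modified system `F ⊗ M`: transitions on actions outside the domain of the error
model are kept, and a transition `(s, σ₂, t)` is added whenever there is `(s, σ₁, t) ∈ δ`
with `M(σ₁, σ₂) ≠ ⊥`. -/
def modify {Q Act : Type} {D : Set Act} (F : IA Q Act) (M : ErrorModel Act D) : IA Q Act where
  init := F.init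
  AI := F.AI
  AO := F.AO
  delta := fun s b t => (b ∉ D ∧ F.delta s b t) ∨ ∃ a, F.delta s a t ∧ M.M a b ≠ none

/-- The weight function `ω_M` of the modified system `F ⊗ M`:
`ω_M(s, σ₂, t) = min { M(σ₁,σ₂) | (s,σ₁,t) ∈ δ }` (and `0` on unmodified transitions). -/
noncomputable def mweight {Q Act : Type} {D : Set Act} (F : IA Q Act) (M : ErrorModel Act D) :
    Q → Act → Q → ℕ :=
  fun s b t => sInf {n : ℕ | ∃ a, F.delta s a t ∧ M.M a b = some n}

/-! ### Composition -/

/-- The action alphabet of `F`. -/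
def acts {Q Act : Type} (F : IA Q Act) : Set Act := F.AI ∪ F.AO

/-- The shared actions of `F` and `G`. -/
def shared {Q R Act : Type} (F : IA Q Act) (G : IA R Act) : Set Act := F.acts ∩ G.acts

/-- `F` and `G` are composable: their inputs do not mix, nor do their outputs. -/
def Composable {Q R Act : Type} (F : IA Q Act) (G : IA R Act) : Prop :=
  Disjoint F.AI G.AI ∧ Disjoint F.AO G.AO

/-- The product automaton `F ⊗ G`. -/
def prod {Q R Act : Type} (F : IA Q Act) (G : IA R Act) : IA (Q × R) Act where
  init := (F.init, G.init)
  AI := (F.AI ∪ G.AI) \ shared F G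
  AO := F.AO ∪ G.AO
  delta := fun s σ t =>
    (σ ∉ shared F G ∧ F.delta s.1 σ t.1 ∧ s.2 = t.2) ∨
    (σ ∉ shared F G ∧ G.delta s.2 σ t.2 ∧ s.1 = t.1) ∨
    (σ ∈ shared F G ∧ F.delta s.1 σ t.1 ∧ G.delta s.2 σ t.2)

/-- A state `(p, q)` of the product `F ⊗ G` is an error state. -/
def errorState {Q R Act : Type} (F : IA Q Act) (G : IA R Act) (s : Q × R) : Prop :=
  ∃ σ ∈ shared F G,
    (σ ∈ F.enabledO s.1 ∧ σ ∉ G.enabledI s.2) ∨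
    (σ ∈ G.enabledO s.2 ∧ σ ∉ F.enabledI s.1)

/-- One step of the product using only output actions. -/
def outputStep {Q R Act : Type} (F : IA Q Act) (G : IA R Act) (s t : Q × R) : Prop :=
  ∃ σ ∈ (F.prod G).AO, (F.prod G).delta s σ t

/-- A product state is compatible if no error state is reachable from it using only
output actions. -/
def compatibleState {Q R Act : Type} (F : IA Q Act) (G : IA R Act) (s : Q × R) : Prop :=
  ∀ t, Relation.ReflTransGen (outputStep F G) s t → ¬ errorState F G t

/-- `F` and `G` are compatible (`F ∼ G`): the initial state of `F ⊗ G` is compatible. -/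
def Compatible {Q R Act : Type} (F : IA Q Act) (G : IA R Act) : Prop :=
  compatibleState F G (F.init, G.init)

/-- The composition `F ∥ G`: the product restricted by removing input-action transitions
leading from compatible to incompatible states. -/
def par {Q R Act : Type} (F : IA Q Act) (G : IA R Act) : IA (Q × R) Act where
  init := (F.init, G.init)
  AI := (F.prod G).AI
  AO := (F.prod G).AO
  delta := fun s σ t => (F.prod G).delta s σ t ∧
    ¬(σ ∈ (F.prod G).AI ∧ compatibleState F G s ∧ ¬ compatibleState F G t)

end IA

/-- The output error model `MO` is restricted with respect to `G` (for the component `F`):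
for `σ₁ ≠ σ₂`, if `MO(σ₁,σ₂) ≠ ⊥` then `σ₂ ∈ AO_{F∥G} \ AO_G`. -/
def OutRestricted {Q R Act : Type} {DO : Set Act} (MO : ErrorModel Act DO)
    (F : IA Q Act) (G : IA R Act) : Prop :=
  ∀ a b, a ≠ b → MO.M a b ≠ none → b ∈ (F.par G).AO \ G.AO

/-- The input error model `MI` is restricted with respect to `G` (for the component `F'`):
for `σ₁ ≠ σ₂`, if `MI(σ₁,σ₂) ≠ ⊥` then `σ₂ ∈ AI_{F'∥G} \ AI_G`. -/
def InRestricted {Q' R Act : Type} {DI : Set Act} (MI : ErrorModel Act DI)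
    (F' : IA Q' Act) (G : IA R Act) : Prop :=
  ∀ a b, a ≠ b → MI.M a b ≠ none → b ∈ (F'.par G).AI \ G.AI

/-! ### The alternating simulation game -/

/-- States of the alternating simulation game for automata `X` (states `Q`) and
`Y` (states `Q'`): the error state `err`, Player-1 states `st q none q'` (the `#` states)
and Player-2 states `st q (some σ) q'`. -/
inductive GS (Q Q' Act : Type)
  | err : GS Q Q' Act
  | st : Q → Option Act → Q' → GS Q Q' Act

/-- Player-2 states of the simulation game are those carrying an action to be matched. -/
def GS.isP2 {Q Q' Act : Type} : GS Q Q' Act → Prop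
  | .st _ (some _) _ => True
  | _ => False

/-- The primary edges of the alternating simulation game `H_{X,Y}`:
Player 1 chooses an input transition of `X` or an output transition of `Y`;
Player 2 matches by an input transition of `Y` or an output transition of `X`. -/
def rawEdge {Q Q' Act : Type} (X : IA Q Act) (Y : IA Q' Act) :
    GS Q Q' Act → GS Q Q' Act → Prop
  | .st s none s', .st t (some σ) t' =>
      (σ ∈ X.AI ∧ X.delta s σ t ∧ t' = s') ∨ (σ ∈ Y.AO ∧ Y.delta s' σ t' ∧ t = s)
  | .st s (some σ) s', .st t none t' =>
      (σ ∈ X.AI ∧ Y.delta s' σ t' ∧ t = s) ∨ (σ ∈ Y.AO ∧ X.delta s σ t ∧ t' = s')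
  | _, _ => False

/-- The alternating simulation game `H_{X,Y}`: its edges are the primary edges, plus an
edge to `err` from every stuck Player-2 state, and a self-loop on every stuck Player-1
state (in particular on `err`). -/
def simGame {Q Q' Act : Type} (X : IA Q Act) (Y : IA Q' Act) : GameGraph (GS Q Q' Act) where
  S1 := {s | ¬ s.isP2}
  S2 := {s | s.isP2}
  partition := fun _ => Iff.rfl
  E := fun x y => rawEdge X Y x y ∨
    (x.isP2 ∧ (∀ z, ¬ rawEdge X Y x z) ∧ y = GS.err) ∨
    (¬ x.isP2 ∧ (∀ z, ¬ rawEdge X Y x z) ∧ y = x)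
  init := GS.st X.init none Y.init
  serial := by
    intro s
    by_cases h : ∃ z, rawEdge X Y s z
    · obtain ⟨z, hz⟩ := h
      exact ⟨z, Or.inl hz⟩
    · push_neg at h
      by_cases h2 : s.isP2
      · exact ⟨GS.err, Or.inr (Or.inl ⟨h2, h, rfl⟩)⟩
      · exact ⟨s, Or.inr (Or.inr ⟨h2, h, rfl⟩)⟩

/-- The weights of the quantitative simulation game: edges leaving Player-1 states get
weight `0`, except around `err` where the weight is the maximal finite weight `W`; an edge
leaving a Player-2 state gets twice the weight of the matched transition (`wY` on the
matched input transition of `Y`, `wX` on the matched output transition of `X`). -/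
noncomputable def gameWeight {Q Q' Act : Type} (X : IA Q Act)
    (wX : Q → Act → Q → ℕ) (wY : Q' → Act → Q' → ℕ) (W : ℕ) :
    GS Q Q' Act → GS Q Q' Act → ℤ :=
  fun x y =>
    match x, y with
    | .err, _ => (W : ℤ)
    | _, .err => (W : ℤ)
    | .st s (some σ) s', .st t none t' =>
        if σ ∈ X.AI then 2 * (wY s' σ t' : ℤ) else 2 * (wX s σ t : ℤ)
    | _, _ => 0

/-- The maximal finite weight assigned by the two error models. -/
noncomputable def maxW {Act : Type} {DO DI : Set Act}
    (MO : ErrorModel Act DO) (MI : ErrorModel Act DI) : ℕ :=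
  sSup {n : ℕ | (∃ a b, MO.M a b = some n) ∨ (∃ a b, MI.M a b = some n)}

/-- The interface simulation distance `d^{LimAvg}(F ⊗ MO, F' ⊗ MI)`: the value of the
quantitative simulation game `H_{F⊗MO, F'⊗MI}` with the limit-average objective. -/
noncomputable def distLimAvg {Q Q' Act : Type} {DO DI : Set Act}
    (F : IA Q Act) (MO : ErrorModel Act DO) (F' : IA Q' Act) (MI : ErrorModel Act DI) :
    EReal :=
  (simGame (F.modify MO) (F'.modify MI)).supInf
    (limAvg (gameWeight (F.modify MO) (F.mweight MO) (F'.mweight MI) (maxW MO MI)))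

/-- The interface simulation distance `d^{Disc_λ}(F ⊗ MO, F' ⊗ MI)`: the value of the
quantitative simulation game `H_{F⊗MO, F'⊗MI}` with the discounted-sum objective. -/
noncomputable def distDisc {Q Q' Act : Type} {DO DI : Set Act} (lam : ℝ)
    (F : IA Q Act) (MO : ErrorModel Act DO) (F' : IA Q' Act) (MI : ErrorModel Act DI) :
    EReal :=
  (simGame (F.modify MO) (F'.modify MI)).supInf
    (disc lam (gameWeight (F.modify MO) (F.mweight MO) (F'.mweight MI) (maxW MO MI)))

/-! ### Abstractions -/

namespace IA

/-- The `∀∃` abstraction of `F` with respect to an equivalence relation on its states: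
input transitions are abstracted universally, output transitions existentially. -/
def absFE {Q Act : Type} (F : IA Q Act) (s : Setoid Q) : IA (Quotient s) Act where
  init := Quotient.mk s F.init
  AI := F.AI
  AO := F.AO
  delta := fun c σ c' =>
    (σ ∈ F.AI ∧ ∀ q, Quotient.mk s q = c → ∃ q', Quotient.mk s q' = c' ∧ F.delta q σ q') ∨
    (σ ∈ F.AO ∧ ∃ q q', Quotient.mk s q = c ∧ Quotient.mk s q' = c' ∧ F.delta q σ q')

/-- The `∃∀` abstraction of `F` with respect to an equivalence relation on its states:
input transitions are abstracted existentially, output transitions universally. -/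
def absEF {Q Act : Type} (F : IA Q Act) (s : Setoid Q) : IA (Quotient s) Act where
  init := Quotient.mk s F.init
  AI := F.AI
  AO := F.AO
  delta := fun c σ c' =>
    (σ ∈ F.AI ∧ ∃ q q', Quotient.mk s q = c ∧ Quotient.mk s q' = c' ∧ F.delta q σ q') ∨
    (σ ∈ F.AO ∧ ∀ q, Quotient.mk s q = c → ∃ q', Quotient.mk s q' = c' ∧ F.delta q σ q')

end IA

/-- (Lemma 3 of the paper.) Let `F`, `G`, `F'` be BIAs with restricted
error models `MI` (input), `MO` (output), such that `F⊗MO` is composable with `G` and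
`shared(F',G) ⊆ shared(F,G)`. If `F⊗MO ∼ G` and `F⊗MO ⪰ F'⊗MI`, then `F' ∼ G`. -/
theorem compatible_of_refines {Q Q' R Act : Type} [Finite Q] [Finite Q'] [Finite R] [Finite Act]
    (F : IA Q Act) (G : IA R Act) (F' : IA Q' Act)
    (hF : F.IsBIA) (hG : G.IsBIA) (hF' : F'.IsBIA)
    (MO : ErrorModel Act F.AO) (MI : ErrorModel Act F'.AI)
    (hMO : OutRestricted MO F G) (hMI : InRestricted MI F' G)
    (hcomp : IA.Composable (F.modify MO) G)
    (hsh : IA.shared F' G ⊆ IA.shared F G)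
    (hcompat : IA.Compatible (F.modify MO) G)
    (href : IA.Refines (F.modify MO) (F'.modify MI)) :
    IA.Compatible F' G := by
  obtain ⟨hI, hO, S, hS, hS0⟩ := href
  obtain ⟨hcI, hcO⟩ := hcomp
  change F.AI ⊆ F'.AI at hI
  change F'.AO ⊆ F.AO at hO
  change Disjoint F.AI G.AI at hcI
  change Disjoint F.AO G.AO at hcO
  have dF := Set.disjoint_left.1 hF.disj
  have dG := Set.disjoint_left.1 hG.disj
  have dF' := Set.disjoint_left.1 hF'.disj
  have dO := Set.disjoint_left.1 hcO
  -- output moves of F' are matched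
  have hout : ∀ p p' σ t', S p p' → σ ∈ F'.AO → F'.delta p' σ t' →
      ∃ t, (F.modify MO).delta p σ t ∧ S t t' := by
    intro p p' σ t' h hσ hd
    exact (hS p p' h).2 σ hσ t' (Or.inl ⟨fun h => dF' h hσ, hd⟩)
  -- shared inputs of F are matched without error
  have hin : ∀ p p' σ t, S p p' → σ ∈ F.AI → σ ∈ G.AO → (F.modify MO).delta p σ t →
      ∃ t', F'.delta p' σ t' ∧ S t t' := by
    intro p p' σ t h hσ hσG hd
    obtain ⟨t', ht', hR⟩ := (hS p p' h).1 σ hσ t hd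
    refine ⟨t', ?_, hR⟩
    rcases ht' with ⟨hn, _⟩ | ⟨a, ha, hM⟩
    · exact absurd (hI hσ) hn
    · by_cases hab : a = σ
      · exact hab ▸ ha
      · exact absurd ⟨Or.inl (hI hσ), Or.inr hσG⟩ (hMI a σ hab hM).1.2
  have hAI : ∀ σ, σ ∈ IA.shared F' G → σ ∈ G.AO → σ ∈ F.AI := by
    intro σ h hσ
    rcases (hsh h).1 with h1 | h1
    · exact h1
    · exact absurd hσ (dO h1)
  -- invariant
  have inv : ∀ x, Relation.ReflTransGen (IA.outputStep F' G) (F'.init, G.init) x →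
      ∃ p, S p x.1 ∧ Relation.ReflTransGen (IA.outputStep (F.modify MO) G)
        (F.init, G.init) (p, x.2) := by
    intro x hx
    induction hx with
    | refl => exact ⟨F.init, hS0, .refl⟩
    | @tail y z _ hyz ih =>
      obtain ⟨p, hp, hreach⟩ := ih
      obtain ⟨y1, y2⟩ := y
      obtain ⟨z1, z2⟩ := z
      obtain ⟨σ, hσ, hd⟩ := hyz
      change σ ∈ F'.AO ∪ G.AO at hσ
      rcases hd with ⟨hns, hd, he⟩ | ⟨hns, hd, he⟩ | ⟨hs, hd, hdG⟩
      · have hG' : σ ∉ G.acts := fun h => hns ⟨hF'.dom _ _ _ hd, h⟩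
        have hσ' : σ ∈ F'.AO := hσ.resolve_right fun h => hG' (Or.inr h)
        obtain ⟨t, ht, hSt⟩ := hout p _ σ _ hp hσ' hd
        exact ⟨t, hSt, hreach.tail ⟨σ, Or.inl (hO hσ'), Or.inl ⟨fun h => hG' h.2, ht, he⟩⟩⟩
      · have hF1 : σ ∉ F'.acts := fun h => hns ⟨h, hG.dom _ _ _ hd⟩
        have hσ' : σ ∈ G.AO := hσ.resolve_left fun h => hF1 (Or.inr h)
        have hF2 : σ ∉ F.acts := by
          rintro (h | h)
          · exact hF1 (Or.inl (hI h))
          · exact dO h hσ'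
        cases he
        exact ⟨p, hp, hreach.tail ⟨σ, Or.inr hσ', Or.inr (Or.inl ⟨fun h => hF2 h.1, hd, rfl⟩)⟩⟩
      · rcases hσ with hσ | hσ
        · obtain ⟨t, ht, hSt⟩ := hout p _ σ _ hp hσ hd
          exact ⟨t, hSt, hreach.tail
            ⟨σ, Or.inl (hO hσ), Or.inr (Or.inr ⟨hsh hs, ht, hdG⟩)⟩⟩
        · have hi := hAI σ hs hσ
          have hen : σ ∈ (F.modify MO).enabledI p := by
            by_contra hne
            exact hcompat _ hreach ⟨σ, hsh hs, Or.inr ⟨⟨hσ, _, hdG⟩, hne⟩⟩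
          obtain ⟨_, t, ht⟩ := hen
          obtain ⟨t', ht', hSt⟩ := hin p _ σ t hp hi hσ ht
          have := hF'.inputDet _ _ _ _ (hI hi) ht' hd
          subst this
          exact ⟨t, hSt, hreach.tail ⟨σ, Or.inr hσ, Or.inr (Or.inr ⟨hsh hs, ht, hdG⟩)⟩⟩
  rintro ⟨x1, x2⟩ hx ⟨σ, hs, herr⟩
  obtain ⟨p, hp, hreach⟩ := inv _ hx
  rcases herr with ⟨⟨hσ, t', hd⟩, hn⟩ | ⟨⟨hσ, t', hd⟩, hn⟩
  · obtain ⟨t, ht, _⟩ := hout p _ σ _ hp hσ hd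
    exact hcompat _ hreach ⟨σ, hsh hs, Or.inl ⟨⟨hO hσ, t, ht⟩, hn⟩⟩
  · have hi := hAI σ hs hσ
    refine hcompat _ hreach ⟨σ, hsh hs, Or.inr ⟨⟨hσ, t', hd⟩, ?_⟩⟩
    rintro ⟨_, t, ht⟩
    obtain ⟨u, hu, _⟩ := hin p _ σ t hp hi hσ ht
    exact hn ⟨hI hi, u, hu⟩
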